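/- Every finite point set S ⊂ ℝ² in general position admits a plane spanning tree of maximum vertex degree 3 that is 3π/2-open: every vertex has an incident angle of at least 3π/2. -/

import Mathlib

open scoped Classical
open EuclideanGeometry

noncomputable section

abbrev Pt := EuclideanSpace ℝ (Fin 2)

/-- No three points of `S` are collinear. -/
def GenPos (S : Finset Pt) : Prop :=
  ∀ p ∈ S, ∀ q ∈ S, ∀ r ∈ S, p ≠ q → p ≠ r → q ≠ r →
    ¬ Collinear ℝ ({p, q, r} : Set Pt)

/-- A plane straight-line graph on the finite point set `S`: vertices are points of `S`,
edges are recorded as ordered pairs closed under swapping, and two edges that are not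
the same unordered pair may only meet at common endpoints. -/
structure PSLG (S : Finset Pt) where
  E : Finset (Pt × Pt)
  symm : ∀ e ∈ E, (e.2, e.1) ∈ E
  endpts : ∀ e ∈ E, e.1 ∈ S ∧ e.2 ∈ S
  ne : ∀ e ∈ E, e.1 ≠ e.2
  noncross : ∀ e ∈ E, ∀ f ∈ E, e ≠ f → e ≠ (f.2, f.1) →
    ∀ x, x ∈ segment ℝ e.1 e.2 → x ∈ segment ℝ f.1 f.2 →
      (x = e.1 ∨ x = e.2) ∧ (x = f.1 ∨ x = f.2)

/-- The degree of the point `p` in `G`. -/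
def PSLG.deg {S : Finset Pt} (G : PSLG S) (p : Pt) : ℕ :=
  (G.E.filter fun e => e.1 = p).card

/-- The point `p` has an incident angle of size at least `φ` in `G`: all edge directions
at `p` fit in a closed cone of half-angle `π - φ / 2` (for `p` of degree ≤ 1 the maximum
incident angle is `2π`, and this condition holds trivially). -/
def VertexOpen {S : Finset Pt} (G : PSLG S) (p : Pt) (φ : ℝ) : Prop :=
  ∃ d : Pt, d ≠ 0 ∧ ∀ q : Pt, (p, q) ∈ G.E →
    InnerProductGeometry.angle d (q - p) ≤ Real.pi - φ / 2

/-- `G` is `φ`-open: every vertex has an incident angle of size at least `φ`. -/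
def PSLG.IsPhiOpen {S : Finset Pt} (G : PSLG S) (φ : ℝ) : Prop :=
  ∀ p ∈ S, VertexOpen G p φ

/-- `G` is connected on `S`. -/
def PSLG.Connected {S : Finset Pt} (G : PSLG S) : Prop :=
  ∀ p ∈ S, ∀ q ∈ S, Relation.ReflTransGen (fun a b => (a, b) ∈ G.E) p q

/-- `G` is a spanning tree of `S`: connected and with the minimum possible number of
edges (each undirected edge is recorded twice). -/
def PSLG.IsSpanningTree {S : Finset Pt} (G : PSLG S) : Prop :=
  G.Connected ∧ G.E.card = 2 * (S.card - 1)

/-- `G` is a (non-crossing Hamiltonian) spanning path of `S`: a spanning tree of maximum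
vertex degree at most two. -/
def PSLG.IsSpanningPath {S : Finset Pt} (G : PSLG S) : Prop :=
  G.IsSpanningTree ∧ ∀ p ∈ S, G.deg p ≤ 2

/-- `S` is in convex position. -/
def ConvexPos (S : Finset Pt) : Prop :=
  ∀ p ∈ S, p ∉ convexHull ℝ (↑(S.erase p) : Set Pt)

/-- `G` is a triangulation of `S`: a maximal plane straight-line graph, i.e. any further
edge between points of `S` would cross the existing graph. -/
def PSLG.IsTriangulation {S : Finset Pt} (G : PSLG S) : Prop :=
  ∀ p ∈ S, ∀ q ∈ S, p ≠ q → (p, q) ∉ G.E →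
    ∃ e ∈ G.E, ∃ x, x ∈ segment ℝ p q ∧ x ∈ segment ℝ e.1 e.2 ∧
      ¬((x = p ∨ x = q) ∧ (x = e.1 ∨ x = e.2))

end


/-- Twice the signed area of the triangle `p q r`, scaled by `s`. -/
def orient (s : ℝ) (p q r : Pt) : ℝ :=
  s * ((q 0 - p 0) * (r 1 - p 1) - (q 1 - p 1) * (r 0 - p 0))

/-- The inner product of `q - p` and `r - p`. -/
def dotAt (p q r : Pt) : ℝ :=
  (q 0 - p 0) * (r 0 - p 0) + (q 1 - p 1) * (r 1 - p 1)

/-- No three distinct points of `V` span a degenerate triangle. -/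
def NonDegenerate (V : Finset Pt) : Prop :=
  ∀ p ∈ V, ∀ q ∈ V, ∀ r ∈ V, p ≠ q → p ≠ r → q ≠ r → orient 1 p q r ≠ 0

theorem NonDegenerate.mono {V W : Finset Pt} (h : NonDegenerate W) (hVW : V ⊆ W) :
    NonDegenerate V :=
  fun p hp q hq r hr => h p (hVW hp) q (hVW hq) r (hVW hr)

/-- The edges of `E` at `p` point into a common closed quadrant. -/
def QuadrantAt (E : Finset (Pt × Pt)) (p : Pt) : Prop :=
  ∃ u v : ℝ, (u ≠ 0 ∨ v ≠ 0) ∧ ∀ q, (p, q) ∈ E →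
    0 ≤ u * (q 0 - p 0) + v * (q 1 - p 1) ∧ 0 ≤ u * (q 1 - p 1) - v * (q 0 - p 0)

/-- The number of edges of `E` at `p`. -/
noncomputable def edgeDeg (E : Finset (Pt × Pt)) (p : Pt) : ℕ := (E.filter fun e => e.1 = p).card

/-- `E` is the edge set of a plane spanning tree of `V` of maximum degree three all of whose
vertices have their edges in a quadrant. -/
structure QuadrantTree (V : Finset Pt) (E : Finset (Pt × Pt)) : Prop where
  symm : ∀ e ∈ E, (e.2, e.1) ∈ E
  endpts : ∀ e ∈ E, e.1 ∈ V ∧ e.2 ∈ V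
  ne : ∀ e ∈ E, e.1 ≠ e.2
  noncross : ∀ e ∈ E, ∀ f ∈ E, e ≠ f → e ≠ (f.2, f.1) →
    ∀ x, x ∈ segment ℝ e.1 e.2 → x ∈ segment ℝ f.1 f.2 →
      (x = e.1 ∨ x = e.2) ∧ (x = f.1 ∨ x = f.2)
  conn : ∀ p ∈ V, ∀ q ∈ V, Relation.ReflTransGen (fun a b => (a, b) ∈ E) p q
  card : E.card + 2 = 2 * V.card
  deg : ∀ p, edgeDeg E p ≤ 3
  quadrant : ∀ p, QuadrantAt E p

theorem pt_ext {p q : Pt} (h0 : p 0 = q 0) (h1 : p 1 = q 1) : p = q := by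
  ext i
  fin_cases i
  · exact h0
  · exact h1

theorem coord_ne {p q : Pt} (h : p ≠ q) : p 0 - q 0 ≠ 0 ∨ p 1 - q 1 ≠ 0 := by
  by_contra! hc
  exact h (pt_ext (by linarith [hc.1]) (by linarith [hc.2]))

theorem GenPos.nonDegenerate {S : Finset Pt} (h : GenPos S) : NonDegenerate S := by
  intro p hp q hq r hr hpq hpr hqr h0
  refine h p hp q hq r hr hpq hpr hqr ?_
  rw [collinear_iff_of_mem (p₀ := p) (by simp)]
  refine ⟨q - p, ?_⟩
  simp only [orient, one_mul] at h0
  have hr' : ∃ t : ℝ, r = t • (q - p) +ᵥ p := by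
    rcases coord_ne hpq.symm with hx | hx
    · refine ⟨(r 0 - p 0) / (q 0 - p 0), pt_ext ?_ ?_⟩
      · simp
        field_simp
        ring
      · simp
        field_simp
        linarith
    · refine ⟨(r 1 - p 1) / (q 1 - p 1), pt_ext ?_ ?_⟩
      · simp
        field_simp
        linarith
      · simp
        field_simp
        ring
  intro z hz
  simp only [Set.mem_insert_iff, Set.mem_singleton_iff] at hz
  rcases hz with rfl | rfl | rfl
  · exact ⟨0, by simp⟩
  · exact ⟨1, by simp⟩
  · exact hr'

theorem edgeDeg_union_le (E E' : Finset (Pt × Pt)) (p : Pt) :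
    edgeDeg (E ∪ E') p ≤ edgeDeg E p + edgeDeg E' p := by
  unfold edgeDeg
  rw [Finset.filter_union]
  exact Finset.card_union_le _ _

theorem edgeDeg_eq_zero {E : Finset (Pt × Pt)} {p : Pt} (h : ∀ q, (p, q) ∉ E) :
    edgeDeg E p = 0 := by
  unfold edgeDeg
  rw [Finset.card_eq_zero, Finset.filter_eq_empty_iff]
  rintro ⟨x, y⟩ hxy rfl
  exact h _ hxy

theorem QuadrantTree.edgeDeg_of_notMem {V : Finset Pt} {E : Finset (Pt × Pt)}
    (h : QuadrantTree V E) {p : Pt} (hp : p ∉ V) : edgeDeg E p = 0 :=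
  edgeDeg_eq_zero fun _ hq => hp (h.endpts _ hq).1

theorem QuadrantAt.congr {E E' : Finset (Pt × Pt)} {p : Pt} (h : QuadrantAt E p)
    (hE : ∀ q, (p, q) ∈ E' → (p, q) ∈ E) : QuadrantAt E' p := by
  obtain ⟨u, v, h0, h1⟩ := h
  exact ⟨u, v, h0, fun q hq => h1 q (hE q hq)⟩

theorem quadrantAt_of_orient {E : Finset (Pt × Pt)} {p u : Pt} {s : ℝ} (hs : s = 1 ∨ s = -1)
    (hu : u ≠ p) (h : ∀ q, (p, q) ∈ E → 0 ≤ dotAt p u q ∧ 0 ≤ orient s p u q) :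
    QuadrantAt E p := by
  unfold dotAt orient at h
  rcases hs with rfl | rfl
  · refine ⟨u 0 - p 0, u 1 - p 1, coord_ne hu, fun q hq => ?_⟩
    obtain ⟨h1, h2⟩ := h q hq
    exact ⟨h1, by linarith⟩
  · refine ⟨u 1 - p 1, -(u 0 - p 0), ?_, fun q hq => ?_⟩
    · rcases coord_ne hu with h | h
      · exact Or.inr (neg_ne_zero.2 h)
      · exact Or.inl h
    · obtain ⟨h1, h2⟩ := h q hq
      exact ⟨by linarith, by linarith⟩

/-- A vector in the cone spanned by two vectors at a non-obtuse angle makes a non-obtuse angle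
with the first one. -/
theorem dot_nonneg_of_mem_cone {u0 u1 w0 w1 z0 z1 s : ℝ} (h1 : 0 < s * (u0 * w1 - u1 * w0))
    (hd : 0 ≤ u0 * w0 + u1 * w1) (h2 : 0 ≤ s * (u0 * z1 - u1 * z0))
    (h3 : 0 ≤ s * (z0 * w1 - z1 * w0)) : 0 ≤ u0 * z0 + u1 * z1 := by
  have key : (u0 * z0 + u1 * z1) * (s * (u0 * w1 - u1 * w0)) =
      s * (z0 * w1 - z1 * w0) * (u0 ^ 2 + u1 ^ 2) +
        s * (u0 * z1 - u1 * z0) * (u0 * w0 + u1 * w1) := by ring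
  have : 0 ≤ (u0 * z0 + u1 * z1) * (s * (u0 * w1 - u1 * w0)) := by
    rw [key]
    positivity
  exact nonneg_of_mul_nonneg_left this h1

theorem quadrantTree_singleton (p : Pt) : QuadrantTree {p} ∅ where
  symm := by simp
  endpts := by simp
  ne := by simp
  noncross := by simp
  conn := by
    intro x hx y hy
    rw [Finset.mem_singleton] at hx hy
    subst hx hy
    exact Relation.ReflTransGen.refl
  card := by simp
  deg := by simp [edgeDeg]
  quadrant := fun _ => ⟨1, 0, by simp, by simp⟩

theorem edgeDeg_pair_le {p q : Pt} (h : p ≠ q) (r : Pt) :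
    edgeDeg {(p, q), (q, p)} r ≤ 1 := by
  unfold edgeDeg
  rw [Finset.card_le_one]
  rintro ⟨x, y⟩ hx ⟨x', y'⟩ hx'
  simp only [Finset.mem_filter, Finset.mem_insert, Finset.mem_singleton, Prod.mk.injEq] at hx hx'
  grind

theorem quadrantTree_pair {p q : Pt} (h : p ≠ q) :
    QuadrantTree {p, q} {(p, q), (q, p)} where
  symm := by
    rintro ⟨x, y⟩ he
    simp only [Finset.mem_insert, Finset.mem_singleton, Prod.mk.injEq] at he ⊢
    tauto
  endpts := by
    rintro ⟨x, y⟩ he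
    simp only [Finset.mem_insert, Finset.mem_singleton, Prod.mk.injEq] at he ⊢
    tauto
  ne := by
    rintro ⟨x, y⟩ he
    simp only [Finset.mem_insert, Finset.mem_singleton, Prod.mk.injEq] at he
    grind
  noncross := by
    rintro ⟨x, y⟩ he ⟨x', y'⟩ hf
    simp only [Finset.mem_insert, Finset.mem_singleton, Prod.mk.injEq] at he hf
    intro h1 h2
    exfalso
    grind
  conn := by
    have hpq : Relation.ReflTransGen
        (fun a b => (a, b) ∈ ({(p, q), (q, p)} : Finset (Pt × Pt))) p q :=
      Relation.ReflTransGen.single (by simp)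
    have hqp : Relation.ReflTransGen
        (fun a b => (a, b) ∈ ({(p, q), (q, p)} : Finset (Pt × Pt))) q p :=
      Relation.ReflTransGen.single (by simp)
    intro x hx y hy
    simp only [Finset.mem_insert, Finset.mem_singleton] at hx hy
    rcases hx with rfl | rfl <;> rcases hy with rfl | rfl
    · exact Relation.ReflTransGen.refl
    · exact hpq
    · exact hqp
    · exact Relation.ReflTransGen.refl
  card := by
    have h' : (p, q) ≠ (q, p) := fun hh => h (Prod.mk.inj hh).1
    rw [Finset.card_pair h, Finset.card_pair h']
  deg := fun r => (edgeDeg_pair_le h r).trans (by norm_num)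
  quadrant := by
    intro r
    by_cases hr : r = p
    · refine quadrantAt_of_orient (u := q) (Or.inl rfl) (hr ▸ h.symm) ?_
      intro z hz
      have : z = q := by
        simp only [Finset.mem_insert, Finset.mem_singleton, Prod.mk.injEq] at hz
        grind
      subst this
      exact ⟨by unfold dotAt; nlinarith [sq_nonneg (z 0 - r 0), sq_nonneg (z 1 - r 1)],
        by unfold orient; exact le_of_eq (by ring)⟩
    · by_cases hr' : r = q
      · refine quadrantAt_of_orient (u := p) (Or.inl rfl) (Ne.symm hr) ?_
        intro z hz
        have : z = p := by
          simp only [Finset.mem_insert, Finset.mem_singleton, Prod.mk.injEq] at hz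
          grind
        subst this
        exact ⟨by unfold dotAt; nlinarith [sq_nonneg (z 0 - r 0), sq_nonneg (z 1 - r 1)],
          by unfold orient; exact le_of_eq (by ring)⟩
      · refine ⟨1, 0, by simp, fun z hz => ?_⟩
        simp only [Finset.mem_insert, Finset.mem_singleton, Prod.mk.injEq] at hz
        tauto

/-- Two segments on different sides of a line through `v` can only meet at `v`. -/
theorem segment_inter_of_separated {v e1 e2 f1 f2 x : Pt} {α β : ℝ} (he : e1 ≠ e2)
    (he1 : e1 ≠ v → 0 < α * (e1 0 - v 0) + β * (e1 1 - v 1))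
    (he2 : e2 ≠ v → 0 < α * (e2 0 - v 0) + β * (e2 1 - v 1))
    (hf1 : α * (f1 0 - v 0) + β * (f1 1 - v 1) ≤ 0)
    (hf2 : α * (f2 0 - v 0) + β * (f2 1 - v 1) ≤ 0)
    (hcol : v ≠ f1 → v ≠ f2 → orient 1 v f1 f2 ≠ 0)
    (hxe : x ∈ segment ℝ e1 e2) (hxf : x ∈ segment ℝ f1 f2) :
    (x = e1 ∨ x = e2) ∧ (x = f1 ∨ x = f2) := by
  obtain ⟨c, d, hc, hd, hcd, rfl⟩ := hxe
  obtain ⟨c', d', hc', hd', hcd', hx⟩ := hxf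
  have hx0 : c' * f1 0 + d' * f2 0 = c * e1 0 + d * e2 0 := by
    simpa using congrArg (fun z : Pt => z 0) hx
  have hx1 : c' * f1 1 + d' * f2 1 = c * e1 1 + d * e2 1 := by
    simpa using congrArg (fun z : Pt => z 1) hx
  have hL : c * (α * (e1 0 - v 0) + β * (e1 1 - v 1)) +
      d * (α * (e2 0 - v 0) + β * (e2 1 - v 1)) ≤ 0 := by
    have h1 := mul_nonneg hc' (neg_nonneg.2 hf1)
    have h2 := mul_nonneg hd' (neg_nonneg.2 hf2)
    have hdd : d = 1 - c := by linarith
    have hdd' : d' = 1 - c' := by linarith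
    subst hdd hdd'
    linear_combination h1 + h2 - α * hx0 - β * hx1
  have hv : c • e1 + d • e2 = v ∧ (v = e1 ∨ v = e2) := by
    by_cases h1 : e1 = v
    · subst h1
      have h2 := he2 he.symm
      have hd0 : d = 0 := by
        by_contra hne
        have : 0 < d := lt_of_le_of_ne hd (Ne.symm hne)
        nlinarith [mul_pos this h2]
      have hc1 : c = 1 := by linarith
      subst hd0 hc1
      simp
    · have h1' := he1 h1
      by_cases h2 : e2 = v
      · subst h2
        have hc0 : c = 0 := by
          by_contra hne
          have : 0 < c := lt_of_le_of_ne hc (Ne.symm hne)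
          nlinarith [mul_pos this h1']
        have hd1 : d = 1 := by linarith
        subst hc0 hd1
        simp
      · have h2' := he2 h2
        exfalso
        rcases hc.lt_or_eq with hc0 | hc0
        · nlinarith [mul_pos hc0 h1', mul_nonneg hd h2'.le]
        · have : d = 1 := by linarith
          subst this
          rw [← hc0] at hL
          linarith
  rw [hv.1]
  refine ⟨hv.2, ?_⟩
  by_contra! hne
  refine hcol hne.1 hne.2 ?_
  have hv0 : c * e1 0 + d * e2 0 = v 0 := by
    simpa using congrArg (fun z : Pt => z 0) hv.1
  have hv1 : c * e1 1 + d * e2 1 = v 1 := by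
    simpa using congrArg (fun z : Pt => z 1) hv.1
  have hdd' : d' = 1 - c' := by linarith
  subst hdd'
  unfold orient
  rw [← hv0, ← hv1, ← hx0, ← hx1]
  ring

/-- Two trees sharing exactly one vertex `v` and separated by a line through `v` can be glued. -/
theorem QuadrantTree.union {V W : Finset Pt} {E E' : Finset (Pt × Pt)} {v : Pt} {α β : ℝ}
    (h : QuadrantTree V E) (h' : QuadrantTree W E') (hv : v ∈ V) (hw : v ∈ W)
    (hV : ∀ p ∈ V, p ≠ v → 0 < α * (p 0 - v 0) + β * (p 1 - v 1))
    (hW : ∀ p ∈ W, α * (p 0 - v 0) + β * (p 1 - v 1) ≤ 0)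
    (hnd : NonDegenerate W) (hdeg : edgeDeg E v + edgeDeg E' v ≤ 3)
    (hquad : QuadrantAt (E ∪ E') v) : QuadrantTree (V ∪ W) (E ∪ E') := by
  have hVW : ∀ p, p ∈ V → p ∈ W → p = v := by
    intro p hp hp'
    by_contra hne
    linarith [hV p hp hne, hW p hp']
  have hcross : ∀ e ∈ E, ∀ f ∈ E', ∀ x, x ∈ segment ℝ e.1 e.2 → x ∈ segment ℝ f.1 f.2 →
      (x = e.1 ∨ x = e.2) ∧ (x = f.1 ∨ x = f.2) := by
    intro e he f hf x hxe hxf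
    obtain ⟨a1, a2⟩ := h.endpts e he
    obtain ⟨b1, b2⟩ := h'.endpts f hf
    exact segment_inter_of_separated (h.ne e he) (hV _ a1) (hV _ a2) (hW _ b1)
      (hW _ b2) (fun g1 g2 => hnd v hw _ b1 _ b2 g1 g2 (h'.ne f hf)) hxe hxf
  refine ⟨?_, ?_, ?_, ?_, ?_, ?_, ?_, ?_⟩
  · intro e he
    rw [Finset.mem_union] at he ⊢
    exact he.imp (h.symm e) (h'.symm e)
  · intro e he
    rw [Finset.mem_union] at he
    rw [Finset.mem_union, Finset.mem_union]
    rcases he with he | he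
    · exact ⟨Or.inl (h.endpts e he).1, Or.inl (h.endpts e he).2⟩
    · exact ⟨Or.inr (h'.endpts e he).1, Or.inr (h'.endpts e he).2⟩
  · intro e he
    rw [Finset.mem_union] at he
    exact he.elim (h.ne e) (h'.ne e)
  · intro e he f hf h1 h2 x hxe hxf
    rw [Finset.mem_union] at he hf
    rcases he with he | he <;> rcases hf with hf | hf
    · exact h.noncross e he f hf h1 h2 x hxe hxf
    · exact hcross e he f hf x hxe hxf
    · exact (hcross f hf e he x hxf hxe).symm
    · exact h'.noncross e he f hf h1 h2 x hxe hxf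
  · have lift1 : ∀ p ∈ V, ∀ q ∈ V, Relation.ReflTransGen (fun a b => (a, b) ∈ E ∪ E') p q :=
      fun p hp q hq => Relation.ReflTransGen.mono (fun _ _ hab => Finset.mem_union_left _ hab) _ _
        (h.conn p hp q hq)
    have lift2 : ∀ p ∈ W, ∀ q ∈ W, Relation.ReflTransGen (fun a b => (a, b) ∈ E ∪ E') p q :=
      fun p hp q hq => Relation.ReflTransGen.mono (fun _ _ hab => Finset.mem_union_right _ hab) _ _
        (h'.conn p hp q hq)
    intro p hp q hq
    rw [Finset.mem_union] at hp hq
    refine Relation.ReflTransGen.trans (b := v) ?_ ?_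
    · exact hp.elim (fun hp => lift1 p hp v hv) (fun hp => lift2 p hp v hw)
    · exact hq.elim (fun hq => lift1 v hv q hq) (fun hq => lift2 v hw q hq)
  · have hdisj : Disjoint E E' := by
      rw [Finset.disjoint_left]
      intro e he he'
      apply h.ne e he
      rw [hVW _ (h.endpts e he).1 (h'.endpts e he').1,
        hVW _ (h.endpts e he).2 (h'.endpts e he').2]
    have hinter : V ∩ W = {v} := by
      ext p
      rw [Finset.mem_inter, Finset.mem_singleton]
      exact ⟨fun hp => hVW p hp.1 hp.2, fun hp => hp ▸ ⟨hv, hw⟩⟩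
    have hcard := Finset.card_union_add_card_inter V W
    rw [hinter, Finset.card_singleton] at hcard
    rw [Finset.card_union_of_disjoint hdisj]
    have := h.card
    have := h'.card
    omega
  · intro p
    refine (edgeDeg_union_le E E' p).trans ?_
    by_cases hp : p = v
    · rwa [hp]
    · by_cases hpV : p ∈ V
      · have hpW : p ∉ W := fun hpW => hp (hVW p hpV hpW)
        rw [h'.edgeDeg_of_notMem hpW]
        exact h.deg p
      · rw [h.edgeDeg_of_notMem hpV, zero_add]
        exact h'.deg p
  · intro p
    by_cases hp : p = v
    · rwa [hp]
    · by_cases hpV : p ∈ V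
      · refine (h.quadrant p).congr fun q hq => ?_
        rcases Finset.mem_union.1 hq with hq | hq
        · exact hq
        · exact absurd (hVW p hpV (h'.endpts _ hq).1) hp
      · refine (h'.quadrant p).congr fun q hq => ?_
        rcases Finset.mem_union.1 hq with hq | hq
        · exact absurd (h.endpts _ hq).1 hpV
        · exact hq

/-- `a` is separated by a line from the points of `P`. -/
def IsSeparated (a : Pt) (P : Finset Pt) : Prop :=
  ∃ α β : ℝ, ∀ p ∈ P, 0 < α * (p 0 - a 0) + β * (p 1 - a 1)

/-- Some quadrant tree of `P` together with `a` has `a` as a leaf. -/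
def HasLeafTree (a : Pt) (P : Finset Pt) : Prop :=
  ∃ E, QuadrantTree (insert a P) E ∧ edgeDeg E a ≤ 1

theorem QuadrantTree.ne_of_mem {V : Finset Pt} {E : Finset (Pt × Pt)} (h : QuadrantTree V E)
    {p q : Pt} (hpq : (p, q) ∈ E) : p ∈ V ∧ q ∈ V ∧ q ≠ p :=
  ⟨(h.endpts _ hpq).1, (h.endpts _ hpq).2, (h.ne _ hpq).symm⟩

theorem mem_pair_edges {p q x y : Pt} :
    (x, y) ∈ ({(p, q), (q, p)} : Finset (Pt × Pt)) ↔ (x = p ∧ y = q) ∨ (x = q ∧ y = p) := by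
  simp

theorem orient_neg (s : ℝ) (p q r : Pt) : orient (-s) p q r = orient s q p r := by
  unfold orient
  ring

theorem orient_rotate (s : ℝ) (p q r : Pt) : orient s p q r = orient s q r p := by
  unfold orient
  ring

theorem orient_swap (s : ℝ) (p q r : Pt) : orient s p q r = -orient s q p r := by
  unfold orient
  ring

theorem orient_self_left (s : ℝ) (p r : Pt) : orient s p p r = 0 := by
  unfold orient
  ring

theorem orient_self_right (s : ℝ) (p q : Pt) : orient s p q q = 0 := by
  unfold orient
  ring

theorem orient_self_outer (s : ℝ) (p q : Pt) : orient s p q p = 0 := by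
  unfold orient
  ring

theorem dotAt_self_nonneg (p q : Pt) : 0 ≤ dotAt p q q :=
  add_nonneg (mul_self_nonneg _) (mul_self_nonneg _)

theorem dotAt_comm (p q r : Pt) : dotAt p q r = dotAt p r q := by
  unfold dotAt
  ring

theorem dotAt_add (b b' y : Pt) : dotAt b' y b + dotAt b y b' = dotAt b b' b' := by
  unfold dotAt
  ring

theorem NonDegenerate.orient_ne {V : Finset Pt} (h : NonDegenerate V) {s : ℝ}
    (hs : s = 1 ∨ s = -1) {p q r : Pt} (hp : p ∈ V) (hq : q ∈ V) (hr : r ∈ V) (hpq : p ≠ q)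
    (hpr : p ≠ r) (hqr : q ≠ r) : orient s p q r ≠ 0 := by
  have h1 := h p hp q hq r hr hpq hpr hqr
  unfold orient at h1 ⊢
  rw [one_mul] at h1
  rcases hs with rfl | rfl
  · rwa [one_mul]
  · exact mul_ne_zero (by norm_num) h1

theorem dotAt_nonneg_of_mem_cone {s : ℝ} {p u w z : Pt} (h1 : 0 < orient s p u w)
    (hd : 0 ≤ dotAt p u w) (h2 : 0 ≤ orient s p u z) (h3 : 0 ≤ orient s p z w) :
    0 ≤ dotAt p u z :=
  dot_nonneg_of_mem_cone h1 hd h2 h3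

theorem isSeparated_of_orient {s : ℝ} {v u : Pt} {P : Finset Pt}
    (h : ∀ p ∈ P, 0 < orient s v u p) : IsSeparated v P := by
  refine ⟨-(s * (u 1 - v 1)), s * (u 0 - v 0), fun p hp => ?_⟩
  have := h p hp
  unfold orient at this
  linarith

theorem QuadrantTree.union_of_orient {V W : Finset Pt} {E E' : Finset (Pt × Pt)} {s : ℝ}
    {v u : Pt} (h : QuadrantTree V E) (h' : QuadrantTree W E') (hv : v ∈ V) (hw : v ∈ W)
    (hV : ∀ p ∈ V, p ≠ v → 0 < orient s v u p) (hW : ∀ p ∈ W, orient s v u p ≤ 0)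
    (hnd : NonDegenerate W) (hdeg : edgeDeg E v + edgeDeg E' v ≤ 3)
    (hquad : QuadrantAt (E ∪ E') v) : QuadrantTree (V ∪ W) (E ∪ E') := by
  refine h.union (α := -(s * (u 1 - v 1))) (β := s * (u 0 - v 0)) h' hv hw ?_ ?_ hnd hdeg hquad
  · intro p hp hpv
    have := hV p hp hpv
    unfold orient at this
    linarith
  · intro p hp
    have := hW p hp
    unfold orient at this
    linarith

/-- The part of the tree beyond the line `b b'`, attached to `b'`. -/
theorem exists_tree_beyond {n : ℕ}
    (ih : ∀ (c : Pt) (Q : Finset Pt), Q.card < n → NonDegenerate (insert c Q) →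
      IsSeparated c Q → HasLeafTree c Q)
    {s : ℝ} (hs : s = 1 ∨ s = -1) {F : Finset Pt} {b b' y : Pt} (hFn : F.card ≤ n)
    (hnd : NonDegenerate (insert b' F)) (hF : ∀ p ∈ F, 0 < orient s b' b p) (hy : y ∈ F)
    (hmax : ∀ p ∈ F, orient s b' b p ≤ orient s b' b y) (hdot : 0 ≤ dotAt b' y b) :
    ∃ E, QuadrantTree (insert b' F) E ∧ edgeDeg E b' ≤ 2 ∧
      ∀ q, (b', q) ∈ E → 0 ≤ dotAt b' b q ∧ 0 ≤ orient s b' b q := by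
  have hs' : -s = 1 ∨ -s = -1 := by
    rcases hs with rfl | rfl <;> norm_num
  have hb'F : b' ∉ F := fun h => by
    have := hF b' h
    rw [orient_self_outer] at this
    exact lt_irrefl _ this
  have hyb' : y ≠ b' := fun h => hb'F (h ▸ hy)
  have hbb' : b ≠ b' := fun h => by
    have := hF y hy
    rw [h, orient_self_left] at this
    exact lt_irrefl _ this
  set F₂ := F.filter fun p => 0 < orient s b' y p with hF₂
  set N₂ := F.filter fun p => 0 < orient s y b' p with hN₂
  have hyF₂ : y ∉ F₂ := by simp [hF₂, orient_self_right]
  have hyN₂ : y ∉ N₂ := by simp [hN₂, orient_self_outer]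
  have hb'F₂ : b' ∉ insert y F₂ := by
    rw [Finset.mem_insert]
    rintro (h | h)
    · exact hyb' h.symm
    · exact hb'F (Finset.mem_filter.1 h).1
  have cardlt : ∀ Q ⊆ F, y ∉ Q → Q.card < n := fun Q hQ hyQ =>
    (Finset.card_lt_card ⟨hQ, fun h => hyQ (h hy)⟩).trans_le hFn
  have hsub2 : insert y F₂ ⊆ insert b' F :=
    Finset.insert_subset (Finset.mem_insert_of_mem hy)
      ((Finset.filter_subset _ _).trans (Finset.subset_insert _ _))
  have hsub1 : insert b' N₂ ⊆ insert b' F :=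
    Finset.insert_subset_insert _ (Finset.filter_subset _ _)
  obtain ⟨T₂, hT₂, hdeg₂⟩ := ih y F₂ (cardlt _ (Finset.filter_subset _ _) hyF₂)
    (hnd.mono hsub2) (isSeparated_of_orient (s := -s) (u := b') fun p hp => by
      rw [orient_neg]
      exact (Finset.mem_filter.1 hp).2)
  obtain ⟨T₁, hT₁, hdeg₁⟩ := ih b' N₂ (cardlt _ (Finset.filter_subset _ _) hyN₂)
    (hnd.mono hsub1) (isSeparated_of_orient (s := -s) (u := y) fun p hp => by
      rw [orient_neg]
      exact (Finset.mem_filter.1 hp).2)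
  have hpair := quadrantTree_pair hyb'
  have hpairsub : ({y, b'} : Finset Pt) ⊆ insert b' F := by
    intro p hp
    simp only [Finset.mem_insert, Finset.mem_singleton] at hp ⊢
    rcases hp with rfl | rfl
    · exact Or.inr hy
    · exact Or.inl rfl
  have hyb := hF y hy
  have hA₁ : QuadrantTree (insert y F₂ ∪ {y, b'}) (T₂ ∪ {(y, b'), (b', y)}) := by
    refine hT₂.union_of_orient (s := -s) (u := b') hpair (Finset.mem_insert_self _ _) (by simp)
      ?_ ?_ (hnd.mono hpairsub) (by have := edgeDeg_pair_le hyb' y; omega) ?_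
    · intro p hp hpy
      rw [orient_neg]
      exact (Finset.mem_filter.1 (Finset.mem_of_mem_insert_of_ne hp hpy)).2
    · intro p hp
      simp only [Finset.mem_insert, Finset.mem_singleton] at hp
      rcases hp with rfl | rfl
      · rw [orient_self_outer]
      · rw [orient_self_right]
    · refine quadrantAt_of_orient hs' hyb'.symm fun q hq => ?_
      rcases Finset.mem_union.1 hq with hq | hq
      · obtain ⟨-, hq1, hq2⟩ := hT₂.ne_of_mem hq
        have hqF := Finset.mem_filter.1 (Finset.mem_of_mem_insert_of_ne hq1 hq2)
        have hle := hmax q hqF.1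
        have h0 : 0 < orient (-s) y b' q := by
          rw [orient_neg]
          exact hqF.2
        refine ⟨dot_nonneg_of_mem_cone (s := -s) (w0 := b' 0 - b 0) (w1 := b' 1 - b 1) ?_ ?_
          h0.le ?_, h0.le⟩
        · unfold orient at hyb
          linarith
        · unfold dotAt at hdot
          linarith
        · unfold orient at hle
          linarith
      · rcases mem_pair_edges.1 hq with ⟨-, rfl⟩ | ⟨h, -⟩
        · exact ⟨dotAt_self_nonneg _ _, (orient_self_right _ _ _).ge⟩
        · exact absurd h hyb'
  have hnbr : ∀ q, (b', q) ∈ T₁ ∪ (T₂ ∪ {(y, b'), (b', y)}) →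
      0 ≤ dotAt b' b q ∧ 0 ≤ orient s b' b q := by
    intro q hq
    rcases Finset.mem_union.1 hq with hq | hq
    · obtain ⟨-, hq1, hq2⟩ := hT₁.ne_of_mem hq
      have hqF := Finset.mem_filter.1 (Finset.mem_of_mem_insert_of_ne hq1 hq2)
      have h0 := hF q hqF.1
      refine ⟨dotAt_nonneg_of_mem_cone (w := y) hyb ?_ h0.le ?_, h0.le⟩
      · rwa [dotAt_comm]
      · rw [orient_rotate, orient_rotate]
        exact hqF.2.le
    · rcases Finset.mem_union.1 hq with hq | hq
      · exact absurd (hT₂.ne_of_mem hq).1 hb'F₂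
      · rcases mem_pair_edges.1 hq with ⟨h, -⟩ | ⟨-, rfl⟩
        · exact absurd h.symm hyb'
        · exact ⟨by rwa [dotAt_comm], hyb.le⟩
  have hdegA : edgeDeg (T₂ ∪ {(y, b'), (b', y)}) b' ≤ 1 := by
    refine (edgeDeg_union_le _ _ _).trans ?_
    rw [hT₂.edgeDeg_of_notMem hb'F₂, zero_add]
    exact edgeDeg_pair_le hyb' b'
  have hA₂ : QuadrantTree (insert b' N₂ ∪ (insert y F₂ ∪ {y, b'}))
      (T₁ ∪ (T₂ ∪ {(y, b'), (b', y)})) := by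
    refine hT₁.union_of_orient (s := -s) (u := y) hA₁ (Finset.mem_insert_self _ _) (by simp)
      ?_ ?_ (hnd.mono (Finset.union_subset hsub2 hpairsub)) (by omega)
      (quadrantAt_of_orient hs hbb' hnbr)
    · intro p hp hpb
      rw [orient_neg]
      exact (Finset.mem_filter.1 (Finset.mem_of_mem_insert_of_ne hp hpb)).2
    · intro p hp
      rw [orient_neg, orient_swap, neg_nonpos]
      simp only [Finset.mem_union, Finset.mem_insert, Finset.mem_singleton] at hp
      rcases hp with (rfl | hp) | (rfl | rfl)
      · rw [orient_self_right]
      · exact (Finset.mem_filter.1 hp).2.le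
      · rw [orient_self_right]
      · rw [orient_self_outer]
  have hV : insert b' N₂ ∪ (insert y F₂ ∪ {y, b'}) = insert b' F := by
    refine (Finset.union_subset hsub1 (Finset.union_subset hsub2 hpairsub)).antisymm ?_
    intro p hp
    simp only [Finset.mem_union, Finset.mem_insert, Finset.mem_singleton, hF₂, hN₂,
      Finset.mem_filter]
    rcases Finset.mem_insert.1 hp with rfl | hpF
    · exact Or.inl (Or.inl rfl)
    · by_cases hpy : p = y
      · exact Or.inr (Or.inl (Or.inl hpy))
      · have hne := hnd.orient_ne hs (Finset.mem_insert_self _ _)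
          (Finset.mem_insert_of_mem hy) hp hyb'.symm (fun h => hb'F (h ▸ hpF)) (Ne.symm hpy)
        rcases hne.lt_or_gt with h | h
        · refine Or.inl (Or.inr ⟨hpF, ?_⟩)
          rw [orient_swap]
          linarith
        · exact Or.inr (Or.inl (Or.inr ⟨hpF, h⟩))
  rw [hV] at hA₂
  exact ⟨_, hA₂, (edgeDeg_union_le _ _ _).trans (by omega), hnbr⟩

/-- Assembling a tree on `insert a P`, where the lines `a b` and `a b'` support `P`, from a tree
beyond the line `b b'`. -/
theorem hasLeafTree_of_tree_beyond
    {s : ℝ} (hs : s = 1 ∨ s = -1) {P : Finset Pt} {a b b' : Pt}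
    (ih : ∀ (c : Pt) (Q : Finset Pt), Q.card < P.card → NonDegenerate (insert c Q) →
      IsSeparated c Q → HasLeafTree c Q)
    (hnd : NonDegenerate (insert a P)) (hb : b ∈ P) (hb' : b' ∈ P) (hbb' : b ≠ b')
    (hsupp : ∀ p ∈ P, p ≠ b → 0 < orient s a b p) (hdot : 0 ≤ dotAt b a b')
    {E : Finset (Pt × Pt)} (hE : QuadrantTree (insert b' (P.filter fun p => 0 < orient s b' b p)) E)
    (hEdeg : edgeDeg E b' ≤ 2)
    (hEnbr : ∀ q, (b', q) ∈ E → 0 ≤ dotAt b' b q ∧ 0 ≤ orient s b' b q) :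
    HasLeafTree a P := by
  set F := P.filter fun p => 0 < orient s b' b p with hF
  set N := P.filter fun p => 0 < orient s b b' p with hN
  have hPa : P ⊆ insert a P := Finset.subset_insert _ _
  have haP : a ∉ P := by
    intro ha
    by_cases hab : a = b
    · have := hsupp b' hb' hbb'.symm
      rw [hab, orient_self_left] at this
      exact lt_irrefl _ this
    · have := hsupp a ha hab
      rw [orient_self_outer] at this
      exact lt_irrefl _ this
  have hba : b ≠ a := fun h => haP (h ▸ hb)
  have hNP : insert b N ⊆ P := Finset.insert_subset hb (Finset.filter_subset _ _)
  have hFP : insert b' F ⊆ P := Finset.insert_subset hb' (Finset.filter_subset _ _)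
  have hpairP : ({b', b} : Finset Pt) ⊆ P :=
    Finset.insert_subset hb' (Finset.singleton_subset_iff.2 hb)
  have hbF : b ∉ insert b' F := by simp [hF, orient_self_right, hbb']
  have hb'N : b' ∉ insert b N := by simp [hN, orient_self_right, hbb'.symm]
  have hb'N' : b' ∉ N := fun h => hb'N (Finset.mem_insert_of_mem h)
  obtain ⟨T, hT, hTdeg⟩ := ih b N
    (Finset.card_lt_card ⟨Finset.filter_subset _ _, fun h => hb'N' (h hb')⟩)
    (hnd.mono (hNP.trans hPa)) (isSeparated_of_orient (s := s) (u := b') fun p hp =>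
      (Finset.mem_filter.1 hp).2)
  have hA₃ : QuadrantTree (insert b' F ∪ {b', b}) (E ∪ {(b', b), (b, b')}) := by
    refine hE.union_of_orient (s := s) (u := b) (quadrantTree_pair hbb'.symm)
      (Finset.mem_insert_self _ _) (by simp) ?_ ?_ (hnd.mono (hpairP.trans hPa))
      (by have := edgeDeg_pair_le hbb'.symm b'; omega) ?_
    · intro p hp hpb
      exact (Finset.mem_filter.1 (Finset.mem_of_mem_insert_of_ne hp hpb)).2
    · intro p hp
      simp only [Finset.mem_insert, Finset.mem_singleton] at hp
      rcases hp with rfl | rfl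
      · rw [orient_self_outer]
      · rw [orient_self_right]
    · refine quadrantAt_of_orient hs hbb' fun q hq => ?_
      rcases Finset.mem_union.1 hq with hq | hq
      · exact hEnbr q hq
      · rcases mem_pair_edges.1 hq with ⟨-, rfl⟩ | ⟨h, -⟩
        · exact ⟨dotAt_self_nonneg _ _, (orient_self_right _ _ _).ge⟩
        · exact absurd h hbb'.symm
  have hab' : 0 < orient s b b' a := by
    rw [← orient_rotate]
    exact hsupp b' hb' hbb'.symm
  have hnbr : ∀ q, (b, q) ∈ (T ∪ (E ∪ {(b', b), (b, b')})) ∪ {(b, a), (a, b)} →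
      0 ≤ dotAt b b' q ∧ 0 ≤ orient s b b' q := by
    intro q hq
    rcases Finset.mem_union.1 hq with hq | hq
    · rcases Finset.mem_union.1 hq with hq | hq
      · obtain ⟨-, hq1, hq2⟩ := hT.ne_of_mem hq
        have hqN := Finset.mem_filter.1 (Finset.mem_of_mem_insert_of_ne hq1 hq2)
        refine ⟨dotAt_nonneg_of_mem_cone hab' (by rwa [dotAt_comm]) hqN.2.le ?_, hqN.2.le⟩
        rw [← orient_rotate]
        exact (hsupp q hqN.1 hq2).le
      · rcases Finset.mem_union.1 hq with hq | hq
        · exact absurd (hE.ne_of_mem hq).1 hbF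
        · rcases mem_pair_edges.1 hq with ⟨h, -⟩ | ⟨-, rfl⟩
          · exact absurd h hbb'
          · exact ⟨dotAt_self_nonneg _ _, (orient_self_right _ _ _).ge⟩
    · rcases mem_pair_edges.1 hq with ⟨-, rfl⟩ | ⟨h, -⟩
      · exact ⟨by rwa [dotAt_comm], hab'.le⟩
      · exact absurd h hba
  have hquad := quadrantAt_of_orient hs hbb'.symm hnbr
  have hdegA : edgeDeg (E ∪ {(b', b), (b, b')}) b ≤ 1 := by
    refine (edgeDeg_union_le _ _ _).trans ?_
    rw [hE.edgeDeg_of_notMem hbF, zero_add]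
    exact edgeDeg_pair_le hbb'.symm b
  have hA₄ : QuadrantTree (insert b N ∪ (insert b' F ∪ {b', b}))
      (T ∪ (E ∪ {(b', b), (b, b')})) := by
    refine hT.union_of_orient (s := s) (u := b') hA₃ (Finset.mem_insert_self _ _) (by simp)
      ?_ ?_ (hnd.mono ((Finset.union_subset hFP hpairP).trans hPa)) (by omega)
      (hquad.congr fun q hq => Finset.mem_union_left _ hq)
    · intro p hp hpb
      exact (Finset.mem_filter.1 (Finset.mem_of_mem_insert_of_ne hp hpb)).2
    · intro p hp
      rw [orient_swap, neg_nonpos]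
      simp only [Finset.mem_union, Finset.mem_insert, Finset.mem_singleton] at hp
      rcases hp with (rfl | hp) | (rfl | rfl)
      · rw [orient_self_outer]
      · exact (Finset.mem_filter.1 hp).2.le
      · rw [orient_self_outer]
      · rw [orient_self_right]
  have hV : insert b N ∪ (insert b' F ∪ {b', b}) = P := by
    refine (Finset.union_subset hNP (Finset.union_subset hFP hpairP)).antisymm ?_
    intro p hp
    simp only [Finset.mem_union, Finset.mem_insert, Finset.mem_singleton, hF, hN,
      Finset.mem_filter]
    by_cases hpb : p = b
    · exact Or.inl (Or.inl hpb)
    · by_cases hpb' : p = b'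
      · exact Or.inr (Or.inl (Or.inl hpb'))
      · have hne := hnd.orient_ne hs (hPa hb) (hPa hb') (hPa hp) hbb' (Ne.symm hpb)
          (Ne.symm hpb')
        rcases hne.lt_or_gt with h | h
        · refine Or.inr (Or.inl (Or.inr ⟨hp, ?_⟩))
          rw [orient_swap]
          linarith
        · exact Or.inl (Or.inr ⟨hp, h⟩)
  rw [hV] at hA₄
  have hA₅ : QuadrantTree (P ∪ {b, a})
      ((T ∪ (E ∪ {(b', b), (b, b')})) ∪ {(b, a), (a, b)}) := by
    refine hA₄.union_of_orient (s := -s) (u := a) (quadrantTree_pair hba) hb (by simp)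
      ?_ ?_ (hnd.mono ?_) ?_ hquad
    · intro p hp hpb
      rw [orient_neg]
      exact hsupp p hp hpb
    · intro p hp
      simp only [Finset.mem_insert, Finset.mem_singleton] at hp
      rcases hp with rfl | rfl
      · rw [orient_self_outer]
      · rw [orient_self_right]
    · exact Finset.insert_subset (hPa hb)
        (Finset.singleton_subset_iff.2 (Finset.mem_insert_self _ _))
    · have h1 := edgeDeg_union_le T (E ∪ {(b', b), (b, b')}) b
      have h2 := edgeDeg_pair_le hba b
      omega
  have hV' : P ∪ {b, a} = insert a P := by
    ext p
    simp only [Finset.mem_union, Finset.mem_insert, Finset.mem_singleton]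
    constructor
    · rintro (h | rfl | rfl)
      · exact Or.inr h
      · exact Or.inr hb
      · exact Or.inl rfl
    · rintro (rfl | h)
      · exact Or.inr (Or.inr rfl)
      · exact Or.inl h
  rw [hV'] at hA₅
  refine ⟨_, hA₅, (edgeDeg_union_le _ _ _).trans ?_⟩
  rw [hA₄.edgeDeg_of_notMem haP, zero_add]
  exact edgeDeg_pair_le hba a

theorem hasLeafTree_of_tangents {s : ℝ} (hs : s = 1 ∨ s = -1) {P : Finset Pt} {a b b' y : Pt}
    (ih : ∀ (c : Pt) (Q : Finset Pt), Q.card < P.card → NonDegenerate (insert c Q) →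
      IsSeparated c Q → HasLeafTree c Q)
    (hnd : NonDegenerate (insert a P)) (hb : b ∈ P) (hb' : b' ∈ P) (hbb' : b ≠ b')
    (hsupp : ∀ p ∈ P, p ≠ b → 0 < orient s a b p) (hdot : 0 ≤ dotAt b a b') (hy : y ∈ P)
    (hmax : ∀ p ∈ P, orient s b' b p ≤ orient s b' b y)
    (hydot : 0 < orient s b' b y → 0 ≤ dotAt b' y b) : HasLeafTree a P := by
  by_cases hpos : 0 < orient s b' b y
  · have hsub : insert b' (P.filter fun p => 0 < orient s b' b p) ⊆ insert a P :=
      (Finset.insert_subset hb' (Finset.filter_subset _ _)).trans (Finset.subset_insert _ _)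
    obtain ⟨E, hE, hdeg, hnbr⟩ := exists_tree_beyond (y := y) ih hs
      (Finset.card_filter_le P _) (hnd.mono hsub) (fun p hp => (Finset.mem_filter.1 hp).2)
      (Finset.mem_filter.2 ⟨hy, hpos⟩) (fun p hp => hmax p (Finset.mem_filter.1 hp).1)
      (hydot hpos)
    exact hasLeafTree_of_tree_beyond hs ih hnd hb hb' hbb' hsupp hdot hE hdeg hnbr
  · have hempty : P.filter (fun p => 0 < orient s b' b p) = ∅ :=
      Finset.filter_eq_empty_iff.2 fun p hp h => hpos (h.trans_le (hmax p hp))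
    refine hasLeafTree_of_tree_beyond (E := ∅) hs ih hnd hb hb' hbb' hsupp hdot ?_ ?_ ?_
    · rw [hempty]
      exact quadrantTree_singleton b'
    · simp [edgeDeg]
    · simp

/-- Two points of `P` span with `a` lines supporting `P`. -/
theorem exists_tangents {a : Pt} {P : Finset Pt} (hnd : NonDegenerate (insert a P))
    (hsep : IsSeparated a P) (hcard : 1 < P.card) :
    ∃ b ∈ P, ∃ b' ∈ P, b ≠ b' ∧ (∀ p ∈ P, p ≠ b → 0 < orient 1 a b p) ∧
      ∀ p ∈ P, p ≠ b' → 0 < orient (-1) a b' p := by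
  obtain ⟨α, β, hpos⟩ := hsep
  have haP : ∀ p ∈ P, a ≠ p := by
    rintro p hp rfl
    have := hpos a hp
    simp at this
  have hne : P.Nonempty := Finset.card_pos.1 (by omega)
  set f : Pt → ℝ := fun p => (α * (p 1 - a 1) - β * (p 0 - a 0)) /
    (α * (p 0 - a 0) + β * (p 1 - a 1)) with hf
  have key : ∀ p ∈ P, ∀ q ∈ P, p ≠ q → f p ≤ f q → 0 < orient 1 a p q := by
    intro p hp q hq hpq hle
    simp only [hf] at hle
    rw [div_le_div_iff₀ (hpos p hp) (hpos q hq)] at hle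
    have h0 := hnd a (Finset.mem_insert_self _ _) p (Finset.mem_insert_of_mem hp) q
      (Finset.mem_insert_of_mem hq) (haP p hp) (haP q hq) hpq
    refine lt_of_le_of_ne ?_ h0.symm
    have hw : 0 < α ^ 2 + β ^ 2 := by
      by_contra! hcon
      have hα : α = 0 := by nlinarith [sq_nonneg α, sq_nonneg β]
      have hβ : β = 0 := by nlinarith [sq_nonneg α, sq_nonneg β]
      have := hpos p hp
      rw [hα, hβ] at this
      simp at this
    have hmul : 0 ≤ orient 1 a p q * (α ^ 2 + β ^ 2) := by
      unfold orient
      linarith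
    exact nonneg_of_mul_nonneg_left hmul hw
  obtain ⟨b, hb, hmin⟩ := P.exists_min_image f hne
  obtain ⟨b', hb', hmax⟩ := P.exists_max_image f hne
  have h1 : ∀ p ∈ P, p ≠ b → 0 < orient 1 a b p := fun p hp hpb =>
    key b hb p hp hpb.symm (hmin p hp)
  have h2 : ∀ p ∈ P, p ≠ b' → 0 < orient (-1) a b' p := fun p hp hpb => by
    have := key p hp b' hb' hpb (hmax p hp)
    rwa [orient_neg, orient_rotate]
  refine ⟨b, hb, b', hb', ?_, h1, h2⟩
  rintro rfl
  obtain ⟨p, hp, hpb⟩ := Finset.exists_mem_ne hcard b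
  have h3 := h1 p hp hpb
  have h4 := h2 p hp hpb
  unfold orient at h3 h4
  linarith

theorem dotAt_nonneg_of_obtuse {s : ℝ} {a b b' y : Pt} (h1 : 0 < orient s a b b')
    (h2 : 0 < orient (-s) a b' y) (h3 : 0 < orient s b' b y) (hd : dotAt b' a b ≤ 0) :
    0 ≤ dotAt b' y b := by
  rw [dotAt_comm]
  unfold orient at h1 h2 h3
  unfold dotAt at hd
  refine dot_nonneg_of_mem_cone (s := s) (w0 := b' 0 - a 0) (w1 := b' 1 - a 1) ?_ ?_ h3.le ?_ <;>
    linarith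

theorem hasLeafTree_of_isSeparated (a : Pt) (P : Finset Pt) (hnd : NonDegenerate (insert a P))
    (hsep : IsSeparated a P) : HasLeafTree a P := by
  induction hn : P.card using Nat.strong_induction_on generalizing a P with
  | _ n hrec =>
  have ih : ∀ (c : Pt) (Q : Finset Pt), Q.card < P.card → NonDegenerate (insert c Q) →
      IsSeparated c Q → HasLeafTree c Q :=
    fun c Q hQ h1 h2 => hrec Q.card (hn ▸ hQ) c Q h1 h2 rfl
  rcases Nat.lt_or_ge 1 P.card with hcard | hcard
  · obtain ⟨b, hb, b', hb', hbb', hsupp, hsupp'⟩ := exists_tangents hnd hsep hcard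
    have hne : P.Nonempty := ⟨b, hb⟩
    obtain ⟨y, hy, hmax⟩ := P.exists_max_image (orient 1 b' b) hne
    have hsum := dotAt_add b b' a
    have hsumy := dotAt_add b b' y
    have hnonneg := dotAt_self_nonneg b b'
    have hyb : 0 < orient 1 b' b y → y ≠ b ∧ y ≠ b' := by
      intro h
      constructor
      · rintro rfl
        rw [orient_self_right] at h
        exact lt_irrefl _ h
      · rintro rfl
        rw [orient_self_outer] at h
        exact lt_irrefl _ h
    have hmax' : ∀ p ∈ P, orient (-1) b b' p ≤ orient (-1) b b' y := by
      intro p hp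
      rw [orient_neg, orient_neg]
      exact hmax p hp
    have left : 0 ≤ dotAt b a b' → (0 < orient 1 b' b y → 0 ≤ dotAt b' y b) →
        HasLeafTree a P := fun h1 h2 =>
      hasLeafTree_of_tangents (Or.inl rfl) ih hnd hb hb' hbb' hsupp h1 hy hmax h2
    have right : 0 ≤ dotAt b' a b → (0 < orient 1 b' b y → 0 ≤ dotAt b y b') →
        HasLeafTree a P := fun h1 h2 =>
      hasLeafTree_of_tangents (Or.inr rfl) ih hnd hb' hb hbb'.symm hsupp' h1 hy hmax'
        (by rwa [orient_neg])
    by_cases hd' : dotAt b' a b ≤ 0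
    · exact left (by linarith) fun h => dotAt_nonneg_of_obtuse (hsupp b' hb' hbb'.symm)
        (hsupp' y hy (hyb h).2) h hd'
    · by_cases hd : dotAt b a b' ≤ 0
      · refine right (by linarith) fun h => dotAt_nonneg_of_obtuse (hsupp' b hb hbb') ?_ ?_ hd
        · rw [neg_neg]
          exact hsupp y hy (hyb h).1
        · rwa [orient_neg]
      · by_cases hy' : 0 ≤ dotAt b' y b
        · exact left (by linarith) fun _ => hy'
        · exact right (by linarith) fun _ => by linarith
  · rcases P.eq_empty_or_nonempty with rfl | hne
    · exact ⟨∅, quadrantTree_singleton a, by simp [edgeDeg]⟩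
    · obtain ⟨b, rfl⟩ := Finset.card_eq_one.1 (le_antisymm hcard (Finset.card_pos.2 hne))
      have hab : a ≠ b := by
        rintro rfl
        obtain ⟨α, β, h⟩ := hsep
        have := h a (Finset.mem_singleton_self a)
        simp at this
      exact ⟨_, quadrantTree_pair hab, edgeDeg_pair_le hab a⟩

/-- A point of `S` farthest from the origin is separated from the other points. -/
theorem exists_isSeparated_erase {S : Finset Pt} (hne : S.Nonempty) :
    ∃ a ∈ S, IsSeparated a (S.erase a) := by
  obtain ⟨a, ha, hmax⟩ := S.exists_max_image (fun p : Pt => p 0 ^ 2 + p 1 ^ 2) hne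
  refine ⟨a, ha, -a 0, -a 1, fun p hp => ?_⟩
  obtain ⟨hpa, hpS⟩ := Finset.mem_erase.1 hp
  have hle := hmax p hpS
  have hpos : 0 < (p 0 - a 0) ^ 2 + (p 1 - a 1) ^ 2 := by
    rcases coord_ne hpa with h | h
    · have := pow_pos (abs_pos.2 h) 2
      rw [sq_abs] at this
      linarith [sq_nonneg (p 1 - a 1)]
    · have := pow_pos (abs_pos.2 h) 2
      rw [sq_abs] at this
      linarith [sq_nonneg (p 0 - a 0)]
  simp only at hle
  nlinarith

theorem angle_le_pi_div_four {u v : ℝ} {z : Pt} (huv : u ≠ 0 ∨ v ≠ 0) (hz : z ≠ 0)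
    (h1 : 0 ≤ u * z 0 + v * z 1) (h2 : 0 ≤ u * z 1 - v * z 0) :
    InnerProductGeometry.angle (!₂[u - v, u + v] : Pt) z ≤ Real.pi / 4 := by
  have hf : 0 < u ^ 2 + v ^ 2 := by
    rcases huv with h | h
    · have := sq_pos_of_ne_zero h
      linarith [sq_nonneg v]
    · have := sq_pos_of_ne_zero h
      linarith [sq_nonneg u]
  have hzn : 0 < ‖z‖ := norm_pos_iff.2 hz
  have hzs : ‖z‖ ^ 2 = z 0 ^ 2 + z 1 ^ 2 := by
    rw [EuclideanSpace.real_norm_sq_eq, Fin.sum_univ_two]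
  have hds : ‖(!₂[u - v, u + v] : Pt)‖ ^ 2 = 2 * (u ^ 2 + v ^ 2) := by
    rw [EuclideanSpace.real_norm_sq_eq, Fin.sum_univ_two]
    simp
    ring
  have hdn : 0 < ‖(!₂[u - v, u + v] : Pt)‖ := by
    refine lt_of_le_of_ne (norm_nonneg _) fun h => ?_
    rw [← h] at hds
    linarith
  have hinner : inner ℝ (!₂[u - v, u + v] : Pt) z =
      (u * z 0 + v * z 1) + (u * z 1 - v * z 0) := by
    rw [PiLp.inner_apply, Fin.sum_univ_two]
    simp
    ring
  unfold InnerProductGeometry.angle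
  rw [← Real.arccos_cos (x := Real.pi / 4) (by linarith [Real.pi_pos])
    (by linarith [Real.pi_pos]), Real.cos_pi_div_four]
  refine Real.arccos_le_arccos ?_
  rw [le_div_iff₀ (mul_pos hdn hzn), hinner]
  refine le_of_sq_le_sq ?_ (add_nonneg h1 h2)
  rw [mul_pow, mul_pow, div_pow, Real.sq_sqrt (by norm_num), hzs, hds]
  nlinarith [mul_nonneg h1 h2]

/-- Every finite point set in general position admits a `3π/2`-open plane spanning tree
of maximum vertex degree three. -/
theorem stmt10 (S : Finset Pt) (hgp : GenPos S) (hne : S.Nonempty) :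
    ∃ T : PSLG S, T.IsSpanningTree ∧ (∀ p : Pt, T.deg p ≤ 3) ∧
      T.IsPhiOpen (3 * Real.pi / 2) := by
  obtain ⟨a, ha, hsep⟩ := exists_isSeparated_erase hne
  have hins : insert a (S.erase a) = S := Finset.insert_erase ha
  obtain ⟨E, hE, -⟩ := hasLeafTree_of_isSeparated a (S.erase a)
    (hins.symm ▸ hgp.nonDegenerate) hsep
  rw [hins] at hE
  refine ⟨⟨E, hE.symm, hE.endpts, hE.ne, hE.noncross⟩, ⟨hE.conn, ?_⟩, hE.deg, ?_⟩
  · have := hE.card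
    change E.card = _
    omega
  · intro p _
    obtain ⟨u, v, huv, h⟩ := hE.quadrant p
    refine ⟨!₂[u - v, u + v], ?_, fun q hq => ?_⟩
    · intro h0
      have e0 := congrArg (fun z : Pt => z 0) h0
      have e1 := congrArg (fun z : Pt => z 1) h0
      simp at e0 e1
      rcases huv with hu | hv
      · exact hu (by linarith)
      · exact hv (by linarith)
    · have hle := angle_le_pi_div_four huv (sub_ne_zero.2 (hE.ne _ hq).symm) (h q hq).1 (h q hq).2
      linarith
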